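/- Let R be a commutative noetherian ring, X, Y, Z finitely generated R-modules, and m, n nonnegative integers. If Y belongs to res^m X and Z belongs to res^n Y, then Z belongs to res^{m+n} X. -/

import Mathlib

open CategoryTheory

noncomputable section

variable (R : Type) [CommRing R]

/-- The nonfree locus of a module: primes where the localization is not free. -/
def nonfreeLocus (M : ModuleCat R) : Set (PrimeSpectrum R) :=
  {p | ¬ Module.Free (Localization.AtPrime p.asIdeal)
      (LocalizedModule p.asIdeal.primeCompl M)}

/-- The nonfree locus of a class of modules. -/
def nonfreeLocusSet (𝒳 : Set (ModuleCat R)) : Set (PrimeSpectrum R) :=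
  ⋃ X ∈ 𝒳, nonfreeLocus R X

/-- `N` is a direct summand of `M`. -/
def IsSummand (N M : ModuleCat R) : Prop :=
  ∃ (i : N ⟶ M) (p : M ⟶ N), i ≫ p = 𝟙 N

/-- `0 → L → M → N → 0` is a short exact sequence. -/
def SES (L M N : ModuleCat R) : Prop :=
  ∃ (f : L ⟶ M) (g : M ⟶ N),
    Function.Injective f ∧ Function.Surjective g ∧ Function.Exact f g

/-- A resolving class of finitely generated modules. -/
structure IsResolving (𝒳 : Set (ModuleCat R)) : Prop where
  finite : ∀ M ∈ 𝒳, Module.Finite R M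
  iso_closed : ∀ M N : ModuleCat R, Nonempty (M ≅ N) → M ∈ 𝒳 → N ∈ 𝒳
  proj_mem : ∀ M : ModuleCat R, Module.Finite R M → Module.Projective R M → M ∈ 𝒳
  summand_closed : ∀ M N : ModuleCat R, IsSummand R N M → M ∈ 𝒳 → N ∈ 𝒳
  ext_closed : ∀ L M N : ModuleCat R, SES R L M N → L ∈ 𝒳 → N ∈ 𝒳 → M ∈ 𝒳
  ker_epi_closed : ∀ L M N : ModuleCat R, SES R L M N → M ∈ 𝒳 → N ∈ 𝒳 → L ∈ 𝒳

/-- The resolving closure of a class of modules. -/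
def resClosure (𝒳 : Set (ModuleCat R)) : Set (ModuleCat R) :=
  ⋂₀ {𝒴 | IsResolving R 𝒴 ∧ 𝒳 ⊆ 𝒴}

/-- Finite direct sum of a family of modules. -/
def finDirectSum {n : ℕ} (f : Fin n → ModuleCat R) : ModuleCat R :=
  ModuleCat.of R (∀ i, f i)

/-- The class `res^n X`. -/
def resStep (X : ModuleCat R) : ℕ → Set (ModuleCat R)
  | 0 => {M | ∃ (n : ℕ) (f : Fin n → ModuleCat R),
      (∀ i, f i = X ∨ f i = ModuleCat.of R R) ∧ IsSummand R M (finDirectSum R f)}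
  | (n+1) => {M | ∃ (t : ℕ) (f : Fin t → ModuleCat R),
      (∀ i, (∃ A B, A ∈ resStep X n ∧ B ∈ resStep X n ∧ SES R A (f i) B) ∨
            (∃ A B, A ∈ resStep X n ∧ B ∈ resStep X n ∧ SES R (f i) A B)) ∧
      IsSummand R M (finDirectSum R f)}

/-- `step(X,Y)` : the least `n` with `Y ∈ res^n X`. -/
def step (X Y : ModuleCat R) : ℕ∞ :=
  sInf {n : ℕ∞ | ∃ m : ℕ, n = (m : ℕ∞) ∧ Y ∈ resStep R X m}

/-- A module is indecomposable. -/
def Indec (M : ModuleCat R) : Prop :=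
  Nontrivial M ∧ ∀ (A B : ModuleCat R), Nontrivial A → Nontrivial B →
    IsEmpty (M ≅ ModuleCat.of R (A × B))

/-- `Ext¹`. -/
def ext1 (X Y : ModuleCat R) : ModuleCat R :=
  ((Ext R (ModuleCat R) 1).obj (Opposite.op X)).obj Y

/-- Dimension of a subset of `Spec R` : `sup { dim R/p }`. -/
def dimSet (Z : Set (PrimeSpectrum R)) : WithBot ℕ∞ :=
  ⨆ p ∈ Z, ringKrullDim (R ⧸ (p : PrimeSpectrum R).asIdeal)

/-- The height of `p` with respect to a subset `Z` of `Spec R`. -/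
def heightWithin (Z : Set (PrimeSpectrum R)) (p : PrimeSpectrum R) : ℕ∞ :=
  ⨆ q ∈ Z, ⨆ (h : q ≤ p), Order.height (α := Set.Icc q p) ⟨p, ⟨h, le_rfl⟩⟩

/-- Depth of a module over a local ring : the supremum of lengths of regular
sequences contained in the maximal ideal. -/
def moduleDepth [IsLocalRing R] (M : Type) [AddCommGroup M] [Module R M] : ℕ∞ :=
  ⨆ (rs : List R) (_ : (∀ r ∈ rs, r ∈ IsLocalRing.maximalIdeal R) ∧
      RingTheory.Sequence.IsRegular M rs), (rs.length : ℕ∞)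

/-- The singular locus: primes `p` such that `R_p` is not regular, i.e. the maximal
ideal of `R_p` cannot be generated by `dim R_p` elements. -/
def singularLocus : Set (PrimeSpectrum R) :=
  {p | ¬ ∃ (s : Finset (Localization.AtPrime p.asIdeal)),
      Ideal.span (s : Set (Localization.AtPrime p.asIdeal)) =
        IsLocalRing.maximalIdeal (Localization.AtPrime p.asIdeal) ∧
      (s.card : WithBot ℕ∞) = ringKrullDim (Localization.AtPrime p.asIdeal)}

end

section

variable {R : Type} [CommRing R]

theorem IsSummand.trans {L M N : ModuleCat R} (h : IsSummand R L M) (h' : IsSummand R M N) :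
    IsSummand R L N := by
  obtain ⟨i, p, hip⟩ := h
  obtain ⟨j, q, hjq⟩ := h'
  exact ⟨i ≫ j, q ≫ p, by rw [Category.assoc, reassoc_of% hjq, hip]⟩

theorem IsSummand.of_leftInverse {M N : ModuleCat R} (i : N →ₗ[R] M) (p : M →ₗ[R] N)
    (h : Function.LeftInverse p i) : IsSummand R N M :=
  ⟨ModuleCat.ofHom i, ModuleCat.ofHom p, by ext x; exact h x⟩

/-- The class of direct summands of finite direct sums of modules satisfying `P`. -/
def addClosure (P : ModuleCat R → Prop) : Set (ModuleCat R) :=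
  {M | ∃ (t : ℕ) (f : Fin t → ModuleCat R), (∀ i, P (f i)) ∧ IsSummand R M (finDirectSum R f)}

theorem addClosure_of_isSummand {P : ModuleCat R → Prop} {M N : ModuleCat R}
    (hM : M ∈ addClosure P) (h : IsSummand R N M) : N ∈ addClosure P := by
  obtain ⟨t, f, hf, hs⟩ := hM
  exact ⟨t, f, hf, h.trans hs⟩

theorem pi_mem_addClosure {P : ModuleCat R → Prop} {ι : Type} [Finite ι]
    {f : ι → ModuleCat R} (hf : ∀ i, P (f i)) :
    ModuleCat.of R (∀ i, f i) ∈ addClosure P := by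
  obtain ⟨t, ⟨e⟩⟩ := Finite.exists_equiv_fin ι
  let l : (∀ k : Fin t, f (e.symm k)) ≃ₗ[R] (∀ i, f i) :=
    LinearEquiv.piCongrLeft R (fun i => f i) e.symm
  exact ⟨t, fun k => f (e.symm k), fun k => hf _,
    IsSummand.of_leftInverse (M := finDirectSum R fun k => f (e.symm k))
      (N := ModuleCat.of R (∀ i, f i)) l.symm.toLinearMap l.toLinearMap l.apply_symm_apply⟩

theorem mem_addClosure {P : ModuleCat R → Prop} {M : ModuleCat R} (h : P M) :
    M ∈ addClosure P :=
  ⟨1, fun _ => M, fun _ => h,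
    IsSummand.of_leftInverse (M := finDirectSum R fun _ : Fin 1 => M)
      (LinearMap.pi fun _ : Fin 1 => LinearMap.id) (LinearMap.proj 0) fun _ => rfl⟩

theorem finDirectSum_mem_addClosure {P : ModuleCat R → Prop} {k : ℕ}
    {g : Fin k → ModuleCat R} (hg : ∀ i, g i ∈ addClosure P) :
    finDirectSum R g ∈ addClosure P := by
  choose t f hf i p hip using hg
  refine addClosure_of_isSummand
    (pi_mem_addClosure (f := fun x : Σ a, Fin (t a) => f x.1 x.2) fun x => hf x.1 x.2) ?_
  let j : (∀ a, g a) →ₗ[R] (∀ x : Σ a, Fin (t a), f x.1 x.2) :=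
    LinearMap.pi fun x =>
      (LinearMap.proj x.2 : (∀ b, f x.1 b) →ₗ[R] f x.1 x.2) ∘ₗ (i x.1).hom ∘ₗ LinearMap.proj x.1
  let q : (∀ x : Σ a, Fin (t a), f x.1 x.2) →ₗ[R] (∀ a, g a) :=
    LinearMap.pi fun a => (p a).hom ∘ₗ
      (LinearMap.pi fun b => LinearMap.proj (⟨a, b⟩ : Σ a, Fin (t a)) :
        (∀ x : Σ a, Fin (t a), f x.1 x.2) →ₗ[R] (∀ b, f a b))
  refine IsSummand.of_leftInverse (N := finDirectSum R g) j q fun v => funext fun a => ?_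
  exact ConcreteCategory.congr_hom (hip a) (v a)

theorem resStep_eq_addClosure (X : ModuleCat R) (n : ℕ) :
    ∃ P : ModuleCat R → Prop, resStep R X n = addClosure P := by
  cases n with
  | zero => exact ⟨fun M => M = X ∨ M = ModuleCat.of R R, rfl⟩
  | succ n =>
    exact ⟨fun M => (∃ A B, A ∈ resStep R X n ∧ B ∈ resStep R X n ∧ SES R A M B) ∨
      (∃ A B, A ∈ resStep R X n ∧ B ∈ resStep R X n ∧ SES R M A B), rfl⟩

theorem resStep_of_isSummand {X M N : ModuleCat R} {n : ℕ} (hM : M ∈ resStep R X n)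
    (h : IsSummand R N M) : N ∈ resStep R X n := by
  obtain ⟨P, hP⟩ := resStep_eq_addClosure X n
  rw [hP] at hM ⊢
  exact addClosure_of_isSummand hM h

theorem finDirectSum_mem_resStep {X : ModuleCat R} {n k : ℕ} {g : Fin k → ModuleCat R}
    (hg : ∀ i, g i ∈ resStep R X n) : finDirectSum R g ∈ resStep R X n := by
  obtain ⟨P, hP⟩ := resStep_eq_addClosure X n
  rw [hP] at hg ⊢
  exact finDirectSum_mem_addClosure hg

theorem SES.id_zero (M : ModuleCat R) : SES R M M (ModuleCat.of R PUnit) :=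
  ⟨𝟙 M, 0, fun _ _ h => h, fun _ => ⟨0, rfl⟩, fun x => ⟨fun _ => ⟨x, rfl⟩, fun _ => rfl⟩⟩

theorem punit_mem_resStep (X : ModuleCat R) (n : ℕ) :
    ModuleCat.of R PUnit ∈ resStep R X n := by
  refine resStep_of_isSummand (finDirectSum_mem_resStep (g := Fin.elim0) fun i => i.elim0) ?_
  exact IsSummand.of_leftInverse 0 0 fun _ => rfl

theorem resStep_subset_succ (X : ModuleCat R) (n : ℕ) :
    resStep R X n ⊆ resStep R X (n + 1) := fun M hM =>
  mem_addClosure (P := fun M => (∃ A B, A ∈ resStep R X n ∧ B ∈ resStep R X n ∧ SES R A M B) ∨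
      (∃ A B, A ∈ resStep R X n ∧ B ∈ resStep R X n ∧ SES R M A B))
    (Or.inl ⟨M, ModuleCat.of R PUnit, hM, punit_mem_resStep X n, SES.id_zero M⟩)

theorem self_mem_resStep (X : ModuleCat R) (n : ℕ) : ModuleCat.of R R ∈ resStep R X n := by
  induction n with
  | zero => exact mem_addClosure (P := fun M => M = X ∨ M = ModuleCat.of R R) (Or.inr rfl)
  | succ n ih => exact resStep_subset_succ X n ih

theorem resStep_trans {X Y Z : ModuleCat R} {m n : ℕ} (hY : Y ∈ resStep R X m)
    (hZ : Z ∈ resStep R Y n) : Z ∈ resStep R X (m + n) := by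
  induction n generalizing Z with
  | zero =>
    obtain ⟨t, f, hf, hs⟩ := hZ
    refine resStep_of_isSummand (finDirectSum_mem_resStep fun i => ?_) hs
    rcases hf i with h | h <;> rw [h]
    · exact hY
    · exact self_mem_resStep X m
  | succ n ih =>
    obtain ⟨t, f, hf, hs⟩ := hZ
    refine ⟨t, f, fun i => ?_, hs⟩
    exact (hf i).imp (fun ⟨A, B, hA, hB, h⟩ => ⟨A, B, ih hA, ih hB, h⟩)
      (fun ⟨A, B, hA, hB, h⟩ => ⟨A, B, ih hA, ih hB, h⟩)

end

/-- If `Y ∈ resᵐ X` and `Z ∈ resⁿ Y` then `Z ∈ res^{m+n} X`. -/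
theorem stmt11 (R : Type) [CommRing R] [IsNoetherianRing R]
    (X Y Z : ModuleCat R) (hX : Module.Finite R X) (hY : Module.Finite R Y)
    (hZ : Module.Finite R Z) (m n : ℕ)
    (h1 : Y ∈ resStep R X m) (h2 : Z ∈ resStep R Y n) :
    Z ∈ resStep R X (m + n) := by
  exact resStep_trans h1 h2
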